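/- arXiv:2201.02450 — 10 statements merged into one kernel-verified Lean document; each statement's English description precedes it below -/
import Mathlib

section
/- Assume Condition (A). If a probability distribution Q_X on X attains the channel capacity, i.e., ∑_{x∈X} Q_X(x) D(W_x‖W·Q_X) = C(W), then the divergence D(W_x‖W·Q_X) takes the same value for every x in the support of Q_X. -/
open Real Finset

/-- A probability distribution on a finite type. -/
def IsDist {α : Type*} [Fintype α] (p : α → ℝ) : Prop :=
  (∀ i, 0 ≤ p i) ∧ ∑ i, p i = 1

/-- Kullback–Leibler divergence `D(p‖q) = ∑ p z log (p z / q z)` (natural log). -/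
noncomputable def KL {α : Type*} [Fintype α] (p q : α → ℝ) : ℝ :=
  ∑ z, p z * Real.log (p z / q z)

/-- Shannon entropy `H(p) = -∑ p z log p z` (natural log). -/
noncomputable def Hent {α : Type*} [Fintype α] (p : α → ℝ) : ℝ :=
  -∑ z, p z * Real.log (p z)

/-- Output distribution `W·q` of a channel `W` under input distribution `q`. -/
noncomputable def output {α β : Type*} [Fintype α] [Fintype β]
    (W : α → β → ℝ) (q : α → ℝ) : β → ℝ :=
  fun y => ∑ x, q x * W x y

/-- Mutual information `∑_x q x D(W_x‖W·q)`. -/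
noncomputable def mutInfo {α β : Type*} [Fintype α] [Fintype β]
    (W : α → β → ℝ) (q : α → ℝ) : ℝ :=
  ∑ x, q x * KL (W x) (output W q)

/-- The channel capacity `C(W)`, the maximum of the mutual information over
input distributions. -/
noncomputable def capacity {α β : Type*} [Fintype α] [Fintype β]
    (W : α → β → ℝ) : ℝ :=
  sSup {c | ∃ q, IsDist q ∧ c = mutInfo W q}

lemma output_eq_zero_of_pos {α β : Type*} [Fintype α] [Fintype β] {W : α → β → ℝ}
    (hW : ∀ x y, 0 ≤ W x y) {q : α → ℝ} (hq : ∀ x, 0 ≤ q x) {x : α} (hx : q x ≠ 0) {y : β}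
    (hy : output W q y = 0) : W x y = 0 := by
  have h := (Finset.sum_eq_zero_iff_of_nonneg
    (fun x _ => mul_nonneg (hq x) (hW x y))).1 hy x (Finset.mem_univ x)
  exact (mul_eq_zero.1 h).resolve_left hx

/-- Divergence from the output distribution as a difference of logarithmic terms, for inputs in
the support of the input distribution. -/
lemma KL_output_eq {α β : Type*} [Fintype α] [Fintype β] {W : α → β → ℝ}
    (hW : ∀ x y, 0 ≤ W x y) {q : α → ℝ} (hq : ∀ x, 0 ≤ q x) {x : α} (hx : q x ≠ 0) :
    KL (W x) (output W q) =
      ∑ y, (W x y * Real.log (W x y) - W x y * Real.log (output W q y)) := by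
  refine Finset.sum_congr rfl fun y _ => ?_
  by_cases h : W x y = 0
  · simp [h]
  · rw [Real.log_div h fun h0 => h (output_eq_zero_of_pos hW hq hx h0), mul_sub]

/-- Mutual information as output entropy minus conditional entropy. -/
lemma mutInfo_eq {α β : Type*} [Fintype α] [Fintype β] {W : α → β → ℝ}
    (hW : ∀ x y, 0 ≤ W x y) {q : α → ℝ} (hq : ∀ x, 0 ≤ q x) :
    mutInfo W q = ∑ x, q x * ∑ y, W x y * Real.log (W x y)
      + ∑ y, Real.negMulLog (output W q y) := by
  have h1 : mutInfo W q = ∑ x, (q x * ∑ y, W x y * Real.log (W x y)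
      - ∑ y, q x * W x y * Real.log (output W q y)) := by
    refine Finset.sum_congr rfl fun x _ => ?_
    by_cases hx : q x = 0
    · simp [hx]
    · rw [KL_output_eq hW hq hx, Finset.sum_sub_distrib, mul_sub]
      simp only [Finset.mul_sum, mul_assoc]
  rw [h1, Finset.sum_sub_distrib, Finset.sum_comm, sub_eq_add_neg, ← Finset.sum_neg_distrib]
  congr 1
  refine Finset.sum_congr rfl fun y _ => ?_
  rw [← Finset.sum_mul, Real.negMulLog, neg_mul, output]

lemma Real.negMulLog_le_one {x : ℝ} (hx : 0 ≤ x) : Real.negMulLog x ≤ 1 := by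
  rcases hx.eq_or_lt with rfl | hx
  · simp
  · have h := mul_le_mul_of_nonneg_left (Real.one_sub_inv_le_log_of_pos hx) hx.le
    rw [mul_sub, mul_inv_cancel₀ hx.ne'] at h
    rw [Real.negMulLog]
    linarith

lemma bddAbove_mutInfo {α β : Type*} [Fintype α] [Fintype β] {W : α → β → ℝ}
    (hW : ∀ x, IsDist (W x)) : BddAbove {c | ∃ q, IsDist q ∧ c = mutInfo W q} := by
  refine ⟨Fintype.card β, ?_⟩
  rintro _ ⟨q, hq, rfl⟩
  rw [mutInfo_eq (fun x => (hW x).1) hq.1]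
  have h1 : ∑ x, q x * ∑ y, W x y * Real.log (W x y) ≤ 0 := by
    refine Finset.sum_nonpos fun x _ => mul_nonpos_of_nonneg_of_nonpos (hq.1 x) ?_
    refine Finset.sum_nonpos fun y _ => mul_nonpos_of_nonneg_of_nonpos ((hW x).1 y) ?_
    refine Real.log_nonpos ((hW x).1 y) ?_
    rw [← (hW x).2]
    exact Finset.single_le_sum (fun i _ => (hW x).1 i) (Finset.mem_univ y)
  have h2 : ∑ y, Real.negMulLog (output W q y) ≤ ∑ _y : β, (1 : ℝ) :=
    Finset.sum_le_sum fun y _ => Real.negMulLog_le_one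
      (Finset.sum_nonneg fun x _ => mul_nonneg (hq.1 x) ((hW x).1 y))
  simp only [Finset.sum_const, Finset.card_univ, nsmul_eq_mul, mul_one] at h2
  linarith

lemma IsDist.eventually_add_smul {α : Type*} [Fintype α] {q d : α → ℝ} (hq : IsDist q)
    (hd : ∑ i, d i = 0) (hqd : ∀ i, q i = 0 → d i = 0) :
    ∀ᶠ t : ℝ in nhds 0, IsDist (q + t • d) := by
  have h : ∀ᶠ t : ℝ in nhds 0, ∀ i, 0 ≤ q i + t * d i := by
    refine Filter.eventually_all.2 fun i => ?_
    rcases (hq.1 i).eq_or_lt with h0 | h0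
    · simp [← h0, hqd i h0.symm]
    · have hc : ContinuousAt (fun t : ℝ => q i + t * d i) 0 := by fun_prop
      exact (hc.eventually_const_lt (by simpa using h0)).mono fun t ht => ht.le
  filter_upwards [h] with t ht
  refine ⟨ht, ?_⟩
  simp [Finset.sum_add_distrib, ← Finset.mul_sum, hd, hq.2]

/-- First-order optimality condition for mutual information along a direction supported in the
support of a capacity-achieving input distribution. -/
lemma sum_mul_KL_eq_zero_of_mutInfo_eq_capacity {α β : Type*} [Fintype α] [Fintype β]
    {W : α → β → ℝ} (hW : ∀ x, IsDist (W x)) {q d : α → ℝ} (hq : IsDist q)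
    (hopt : mutInfo W q = capacity W) (hd : ∑ i, d i = 0) (hqd : ∀ i, q i = 0 → d i = 0) :
    ∑ x, d x * KL (W x) (output W q) = 0 := by
  have hW0 : ∀ x y, 0 ≤ W x y := fun x => (hW x).1
  have hev := hq.eventually_add_smul hd hqd
  set f : ℝ → ℝ := fun t => ∑ x, (q x + t * d x) * ∑ y, W x y * Real.log (W x y)
      + ∑ y, Real.negMulLog (output W q y + t * output W d y) with hf
  have hfm : ∀ t, IsDist (q + t • d) → mutInfo W (q + t • d) = f t := by
    intro t ht
    rw [mutInfo_eq hW0 ht.1, hf]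
    simp only [Pi.add_apply, Pi.smul_apply, smul_eq_mul, output, add_mul,
      Finset.sum_add_distrib, Finset.mul_sum, mul_assoc]
  have hmax : IsLocalMax f 0 := by
    filter_upwards [hev] with t ht
    rw [← hfm t ht, ← hfm 0 hev.self_of_nhds, zero_smul, add_zero, hopt]
    exact le_csSup (bddAbove_mutInfo hW) ⟨_, ht, rfl⟩
  have hdout : ∀ y, output W q y = 0 → output W d y = 0 := by
    intro y hy
    refine Finset.sum_eq_zero fun x _ => ?_
    by_cases hx : q x = 0
    · simp [hqd x hx]
    · simp [output_eq_zero_of_pos hW0 hq.1 hx hy]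
  have hderiv : HasDerivAt f (∑ x, d x * ∑ y, W x y * Real.log (W x y)
      + ∑ y, (-Real.log (output W q y) - 1) * output W d y) 0 := by
    refine HasDerivAt.add ?_ ?_
    · refine HasDerivAt.fun_sum fun x _ => ?_
      simpa using (((hasDerivAt_id (0 : ℝ)).mul_const (d x)).const_add (q x)).mul_const
        (∑ y, W x y * Real.log (W x y))
    · refine HasDerivAt.fun_sum fun y _ => ?_
      by_cases hy : output W q y = 0
      · simpa [hy, hdout y hy] using hasDerivAt_const (0 : ℝ) (0 : ℝ)
      · have hl : HasDerivAt (fun t : ℝ => output W q y + t * output W d y)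
            (output W d y) 0 := by
          simpa using ((hasDerivAt_id (0 : ℝ)).mul_const (output W d y)).const_add (output W q y)
        exact HasDerivAt.comp (0 : ℝ) (by simpa using Real.hasDerivAt_negMulLog hy) hl
  have hzero := hmax.hasDerivAt_eq_zero hderiv
  have hKL : ∑ x, d x * KL (W x) (output W q) = ∑ x, (d x * ∑ y, W x y * Real.log (W x y)
      - ∑ y, d x * W x y * Real.log (output W q y)) := by
    refine Finset.sum_congr rfl fun x _ => ?_
    by_cases hx : q x = 0
    · simp [hqd x hx]
    · rw [KL_output_eq hW0 hq.1 hx, Finset.sum_sub_distrib, mul_sub]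
      simp only [Finset.mul_sum, mul_assoc]
  have hout : ∑ y, output W d y = 0 := by
    simp only [output]
    rw [Finset.sum_comm]
    simp [← Finset.mul_sum, (hW _).2, hd]
  have hlog : ∑ x, ∑ y, d x * W x y * Real.log (output W q y)
      = ∑ y, Real.log (output W q y) * output W d y := by
    rw [Finset.sum_comm]
    refine Finset.sum_congr rfl fun y _ => ?_
    rw [← Finset.sum_mul, mul_comm]
    rfl
  simp only [sub_mul, neg_mul, one_mul, Finset.sum_sub_distrib, Finset.sum_neg_distrib,
    hout] at hzero
  rw [hKL, Finset.sum_sub_distrib, hlog]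
  linarith

/-- if a probability distribution attains the channel capacity, then
`D(W_x‖W·Q)` takes the same value for every `x` in the support of `Q`. -/
theorem stmt0 {n₁ n₂ : ℕ} (W : Fin n₁ → Fin n₂ → ℝ)
    (hW : ∀ x, IsDist (W x)) (hA : LinearIndependent ℝ W)
    (Q : Fin n₁ → ℝ) (hQ : IsDist Q)
    (hopt : mutInfo W Q = capacity W) :
    ∀ x, Q x ≠ 0 → ∀ x', Q x' ≠ 0 →
      KL (W x) (output W Q) = KL (W x') (output W Q) := by
  intro x hx x' hx'
  have h := sum_mul_KL_eq_zero_of_mutInfo_eq_capacity hW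
    (d := Pi.single x 1 - Pi.single x' 1) hQ hopt (by simp) (by
      intro i hi
      have h1 : i ≠ x := by rintro rfl; exact hx hi
      have h2 : i ≠ x' := by rintro rfl; exact hx' hi
      simp [h1, h2])
  simpa [sub_mul, Finset.sum_sub_distrib, Pi.single_apply, sub_eq_zero] using h
end

section
/- If the parameters θ = (θ^1,…,θ^{n₂−1}) satisfy the linear system ∑_{j=1}^{n₂−1} h_{i,j} θ^j = −H(W_i) + H(W_{n₂}) for every i ∈ X, then D(W_x‖P_{θ,Y}) = φ(θ) − H(W_{n₂}) for every x ∈ X. -/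
open Real Finset

/-- The log-partition function `φ(θ) = log ∑_y exp(∑_j θ^j f_j(y))`. -/
noncomputable def natPhi {β ι : Type*} [Fintype β] [Fintype ι]
    (f : ι → β → ℝ) (θ : ι → ℝ) : ℝ :=
  Real.log (∑ y, Real.exp (∑ j, θ j * f j y))

/-- The exponential-family distribution `P_{θ,Y}(y) = exp(∑_j θ^j f_j(y) − φ(θ))`. -/
noncomputable def natDist {β ι : Type*} [Fintype β] [Fintype ι]
    (f : ι → β → ℝ) (θ : ι → ℝ) : β → ℝ :=
  fun y => Real.exp (∑ j, θ j * f j y - natPhi f θ)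

/-- Divergence to a member of an exponential family, in terms of the log-partition function,
the entropy and the expectations of the generators. -/
lemma KL_natDist {β ι : Type*} [Fintype β] [Fintype ι] {p : β → ℝ} (hp : ∑ y, p y = 1)
    (f : ι → β → ℝ) (θ : ι → ℝ) :
    KL p (natDist f θ) = natPhi f θ - Hent p - ∑ j, (∑ y, p y * f j y) * θ j := by
  have hterm : ∀ y, p y * Real.log (p y / natDist f θ y) =
      p y * Real.log (p y) - ∑ j, p y * f j y * θ j + p y * natPhi f θ := by
    intro y
    have hsum : ∑ j, p y * f j y * θ j = p y * ∑ j, θ j * f j y := by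
      rw [mul_sum]
      exact sum_congr rfl fun j _ => by ring
    rw [hsum]
    rcases eq_or_ne (p y) 0 with h | h
    · simp [h]
    · rw [natDist, Real.log_div h (Real.exp_ne_zero _), Real.log_exp]
      ring
  simp only [KL, Hent, hterm, sum_add_distrib, sum_sub_distrib, ← sum_mul, hp]
  rw [sum_comm]
  simp only [← sum_mul]
  ring

/-- if `θ` solves the linear system `∑_j h_{i,j} θ^j = −H(W_i)+H(W_{n₂})`
then `D(W_x‖P_{θ,Y}) = φ(θ) − H(W_{n₂})` for every input `x`. -/
theorem stmt3 {n₁ n₂ : ℕ} (hn₂ : 0 < n₂) (hn : n₂ ≤ n₁)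
    (W : Fin n₁ → Fin n₂ → ℝ) (hW : ∀ x, IsDist (W x))
    (f : Fin (n₂ - 1) → Fin n₂ → ℝ) (hf : LinearIndependent ℝ f)
    (hortho : ∀ j, ∑ y, W ⟨n₂ - 1, by omega⟩ y * f j y = 0)
    (θ : Fin (n₂ - 1) → ℝ)
    (hθ : ∀ i : Fin n₁, ∑ j, (∑ y, W i y * f j y) * θ j
        = -Hent (W i) + Hent (W ⟨n₂ - 1, by omega⟩)) :
    ∀ x : Fin n₁, KL (W x) (natDist f θ)
        = natPhi f θ - Hent (W ⟨n₂ - 1, by omega⟩) := by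
  intro x
  rw [KL_natDist (hW x).2, hθ x]
  ring
end

section
/- Let n₁ = d² and let W_1, …, W_{d²} be positive definite density matrices on ℂ^d that are linearly independent over ℝ in the real vector space of Hermitian matrices. Let A_1, …, A_{d²−1} be linearly independent Hermitian d×d matrices with Tr(W_{d²} A_j) = 0 for every j, set h_{i,j} = Tr(W_i A_j), and for θ ∈ ℝ^{d²−1} define φ(θ) = log Tr exp(∑_{j=1}^{d²−1} θ^j A_j) and the density matrix ρ_θ = exp(∑_{j=1}^{d²−1} θ^j A_j − φ(θ)·I). If ∑_{j=1}^{d²−1} h_{i,j} θ^j = −H(W_i) + H(W_{d²}) for every i ∈ {1,…,d²}, then D(W_x‖ρ_θ) = φ(θ) − H(W_{d²}) for every x ∈ {1,…,d²}. -/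
open Real Finset Matrix ComplexOrder

/-- Functional calculus for Hermitian matrices: apply `g : ℝ → ℝ` to the
eigenvalues (junk value `0` on non-Hermitian input). -/
noncomputable def hermCFC {d : ℕ} (g : ℝ → ℝ) (A : Matrix (Fin d) (Fin d) ℂ) :
    Matrix (Fin d) (Fin d) ℂ :=
  if hA : A.IsHermitian then hA.cfc g else 0

/-- Matrix logarithm via the functional calculus on Hermitian matrices. -/
noncomputable def mLog {d : ℕ} : Matrix (Fin d) (Fin d) ℂ → Matrix (Fin d) (Fin d) ℂ :=
  hermCFC Real.log

/-- Matrix exponential via the functional calculus on Hermitian matrices. -/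
noncomputable def mExp {d : ℕ} : Matrix (Fin d) (Fin d) ℂ → Matrix (Fin d) (Fin d) ℂ :=
  hermCFC Real.exp

/-- von Neumann entropy `H(ρ) = −Tr(ρ log ρ)`. -/
noncomputable def qEnt {d : ℕ} (ρ : Matrix (Fin d) (Fin d) ℂ) : ℝ :=
  (-((ρ * mLog ρ).trace)).re

/-- Quantum relative entropy `D(ρ‖σ) = Tr(ρ (log ρ − log σ))`. -/
noncomputable def qRel {d : ℕ} (ρ σ : Matrix (Fin d) (Fin d) ℂ) : ℝ :=
  ((ρ * (mLog ρ - mLog σ)).trace).re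

/-- `φ(θ) = log Tr exp(∑_j θ^j A_j)`. -/
noncomputable def qPhi {d k : ℕ} (A : Fin k → Matrix (Fin d) (Fin d) ℂ)
    (θ : Fin k → ℝ) : ℝ :=
  Real.log ((mExp (∑ j, θ j • A j)).trace.re)

/-- `ρ_θ = exp(∑_j θ^j A_j − φ(θ)·I)`. -/
noncomputable def qRho {d k : ℕ} (A : Fin k → Matrix (Fin d) (Fin d) ℂ)
    (θ : Fin k → ℝ) : Matrix (Fin d) (Fin d) ℂ :=
  mExp (∑ j, θ j • A j - qPhi A θ • (1 : Matrix (Fin d) (Fin d) ℂ))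

/-- `log (exp H) = H` for Hermitian `H`. -/
theorem mLog_mExp {d : ℕ} {H : Matrix (Fin d) (Fin d) ℂ} (hH : H.IsHermitian) :
    mLog (mExp H) = H := by
  have hH' : IsSelfAdjoint H := hH
  have hexp : mExp H = cfc Real.exp H := by
    rw [mExp, hermCFC, dif_pos hH, hH.cfc_eq]
  have hE : (cfc Real.exp H).IsHermitian := cfc_predicate Real.exp H
  rw [hexp, mLog, hermCFC, dif_pos hE, ← hE.cfc_eq, ← cfc_comp' Real.log Real.exp H
    (Real.continuousOn_log.mono (by rintro _ ⟨x, -, rfl⟩; exact (Real.exp_pos x).ne'))]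
  simp only [Real.log_exp]
  exact cfc_id' ℝ H

/-- Expansion of `D(W‖ρ_θ)` for the exponential family `ρ_θ`. -/
theorem qRel_qRho {d k : ℕ} {A : Fin k → Matrix (Fin d) (Fin d) ℂ}
    (hA : ∀ j, (A j).IsHermitian) (θ : Fin k → ℝ) {W : Matrix (Fin d) (Fin d) ℂ}
    (hW : W.trace = 1) :
    qRel W (qRho A θ) = -qEnt W - ∑ j, ((W * A j).trace).re * θ j + qPhi A θ := by
  have hsum : (∑ j, θ j • A j).IsHermitian :=
    isSelfAdjoint_sum _ fun j _ => IsSelfAdjoint.smul (.all (θ j)) (hA j)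
  have hH : (∑ j, θ j • A j - qPhi A θ • (1 : Matrix (Fin d) (Fin d) ℂ)).IsHermitian :=
    hsum.sub (IsSelfAdjoint.smul (.all (qPhi A θ)) (.one _))
  rw [qRel, qRho, mLog_mExp hH, qEnt]
  simp [mul_sub, Finset.mul_sum, Matrix.trace_sum, hW, mul_comm]
  ring

/-- if `θ` solves `∑_j h_{i,j} θ^j = −H(W_i)+H(W_{d²})`, then
`D(W_x‖ρ_θ) = φ(θ) − H(W_{d²})` for every `x`. -/
theorem stmt6 {d : ℕ} (hd : 0 < d)
    (W : Fin (d ^ 2) → Matrix (Fin d) (Fin d) ℂ)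
    (hWpd : ∀ i, (W i).PosDef) (hWtr : ∀ i, (W i).trace = 1)
    (hWli : LinearIndependent ℝ W)
    (A : Fin (d ^ 2 - 1) → Matrix (Fin d) (Fin d) ℂ)
    (hAherm : ∀ j, (A j).IsHermitian) (hAli : LinearIndependent ℝ A)
    (hortho : ∀ j, (W ⟨d ^ 2 - 1, Nat.sub_lt (pow_pos hd 2) one_pos⟩ * A j).trace = 0)
    (θ : Fin (d ^ 2 - 1) → ℝ)
    (hθ : ∀ i, ∑ j, ((W i * A j).trace).re * θ j
        = -qEnt (W i) + qEnt (W ⟨d ^ 2 - 1, Nat.sub_lt (pow_pos hd 2) one_pos⟩)) :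
    ∀ x, qRel (W x) (qRho A θ)
        = qPhi A θ - qEnt (W ⟨d ^ 2 - 1, Nat.sub_lt (pow_pos hd 2) one_pos⟩) := by
  intro x
  rw [qRel_qRho hAherm θ (hWtr x), hθ x]
  ring
end

section
/- Let n₁ = d² and let W_1, …, W_{d²} be positive definite density matrices on ℂ^d that are linearly independent over ℝ in the real vector space of Hermitian matrices (Condition (D)). Then there exists exactly one positive definite density matrix σ on ℂ^d such that D(W_x‖σ) takes the same value for all x ∈ {1,…,d²}. -/
open Real Finset Matrix ComplexOrder

/-- Hermitian matrices that are linearly independent over `ℝ` are linearly independent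
over `ℂ`. -/
lemma linearIndependent_complex_of_isHermitian {ι n : Type*} {W : ι → Matrix n n ℂ}
    (hW : ∀ i, (W i).IsHermitian) (hli : LinearIndependent ℝ W) : LinearIndependent ℂ W := by
  rw [linearIndependent_iff'] at hli ⊢
  intro s g hg
  have entry (a b : n) : ∑ i ∈ s, g i * W i a b = 0 := by
    simpa [Matrix.sum_apply] using congrFun (congrFun hg a) b
  have entry_conj (a b : n) : ∑ i ∈ s, star (g i) * W i a b = 0 := by
    have h := congrArg star (entry b a)
    rw [star_sum, star_zero] at h
    rw [← h]
    refine Finset.sum_congr rfl fun i _ ↦ ?_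
    rw [star_mul', (hW i).apply]
  have hre : ∑ i ∈ s, (g i).re • W i = 0 := by
    ext a b
    have h := congrArg₂ (fun z w ↦ (z + w) / 2) (entry a b) (entry_conj a b)
    simp only [← Finset.sum_add_distrib, Finset.sum_div] at h
    simp only [Matrix.sum_apply, Matrix.smul_apply, Matrix.zero_apply, Complex.real_smul]
    convert h using 1
    · refine Finset.sum_congr rfl fun i _ ↦ ?_
      rw [Complex.re_eq_add_conj, Complex.star_def]
      ring
    · simp
  have him : ∑ i ∈ s, (g i).im • W i = 0 := by
    ext a b
    have h := congrArg₂ (fun z w ↦ (z - w) / (2 * Complex.I)) (entry a b) (entry_conj a b)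
    simp only [← Finset.sum_sub_distrib, Finset.sum_div] at h
    simp only [Matrix.sum_apply, Matrix.smul_apply, Matrix.zero_apply, Complex.real_smul]
    convert h using 1
    · refine Finset.sum_congr rfl fun i _ ↦ ?_
      rw [Complex.im_eq_sub_conj, Complex.star_def]
      ring
    · simp
  intro i hi
  exact Complex.ext (hli s _ hre i hi) (hli s _ him i hi)

/-- A matrix is determined by its traces against a linearly independent family of `d²`
matrices. -/
lemma eq_zero_of_trace_mul_eq_zero {d : ℕ} {W : Fin (d ^ 2) → Matrix (Fin d) (Fin d) ℂ}
    (hli : LinearIndependent ℂ W) {X : Matrix (Fin d) (Fin d) ℂ}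
    (hX : ∀ x, (W x * X).trace = 0) : X = 0 := by
  have hspan : Submodule.span ℂ (Set.range W) = ⊤ :=
    hli.span_eq_top_of_card_eq_finrank' (by simp [Module.finrank_matrix, sq])
  rw [Matrix.ext_iff_trace_mul_left]
  intro Y
  have hY : Y ∈ Submodule.span ℂ (Set.range W) := hspan ▸ Submodule.mem_top
  rw [Matrix.mul_zero, Matrix.trace_zero]
  induction hY using Submodule.span_induction with
  | mem y hy => obtain ⟨x, rfl⟩ := hy; exact hX x
  | zero => simp
  | add y z _ _ hy hz => rw [Matrix.add_mul, Matrix.trace_add, hy, hz, add_zero]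
  | smul c y _ hy => rw [Matrix.smul_mul, Matrix.trace_smul, hy, smul_zero]

/-- The trace of a product of two Hermitian matrices is real. -/
lemma star_trace_mul_of_isHermitian {n : Type*} [Fintype n] {A B : Matrix n n ℂ}
    (hA : A.IsHermitian) (hB : B.IsHermitian) : star (A * B).trace = (A * B).trace := by
  rw [← Matrix.trace_conjTranspose, Matrix.conjTranspose_mul, hA.eq, hB.eq, Matrix.trace_mul_comm]

/-- There is a Hermitian matrix with prescribed real traces against a linearly independent
family of `d²` Hermitian matrices. -/
lemma exists_isHermitian_trace_mul_eq {d : ℕ} {W : Fin (d ^ 2) → Matrix (Fin d) (Fin d) ℂ}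
    (hW : ∀ x, (W x).IsHermitian) (hli : LinearIndependent ℂ W) (a : Fin (d ^ 2) → ℝ) :
    ∃ L : Matrix (Fin d) (Fin d) ℂ, L.IsHermitian ∧ ∀ x, (W x * L).trace = a x := by
  let T : Matrix (Fin d) (Fin d) ℂ →ₗ[ℂ] Fin (d ^ 2) → ℂ :=
    LinearMap.pi fun x ↦ Matrix.traceLinearMap (Fin d) ℂ ℂ ∘ₗ LinearMap.mulLeft ℂ (W x)
  have hT (X x) : T X x = (W x * X).trace := rfl
  have hinj : Function.Injective T := by
    rw [injective_iff_map_eq_zero]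
    exact fun X hX ↦ eq_zero_of_trace_mul_eq_zero hli fun x ↦ by rw [← hT, hX]; rfl
  have hsurj : Function.Surjective T :=
    (LinearMap.injective_iff_surjective_of_finrank_eq_finrank
      (by simp [Module.finrank_matrix, sq])).1 hinj
  obtain ⟨L, hL⟩ := hsurj fun x ↦ (a x : ℂ)
  have hL' (x) : (W x * L).trace = a x := congrFun hL x
  refine ⟨L, sub_eq_zero.1 (eq_zero_of_trace_mul_eq_zero hli fun x ↦ ?_), hL'⟩
  have h := congrArg star (hL' x)
  rw [← Matrix.trace_conjTranspose, Matrix.conjTranspose_mul, (hW x).eq, Matrix.trace_mul_comm,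
    Complex.star_def, Complex.conj_ofReal] at h
  rw [Matrix.mul_sub, Matrix.trace_sub, h, hL' x, sub_self]

lemma mLog_eq_cfc {d : ℕ} {A : Matrix (Fin d) (Fin d) ℂ} (hA : A.IsHermitian) :
    mLog A = cfc Real.log A := by
  rw [mLog, hermCFC, dif_pos hA, hA.cfc_eq]

lemma isHermitian_mLog {d : ℕ} {A : Matrix (Fin d) (Fin d) ℂ} (hA : A.IsHermitian) :
    (mLog A).IsHermitian := by
  rw [mLog_eq_cfc hA]
  exact cfc_predicate Real.log A

lemma Matrix.continuousOn_real_spectrum {d : ℕ} (A : Matrix (Fin d) (Fin d) ℂ) (f : ℝ → ℝ) :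
    ContinuousOn f (spectrum ℝ A) :=
  A.finite_real_spectrum.continuousOn f

lemma Matrix.PosDef.pos_of_mem_spectrum {d : ℕ} {A : Matrix (Fin d) (Fin d) ℂ} (hA : A.PosDef)
    {t : ℝ} (ht : t ∈ spectrum ℝ A) : 0 < t := by
  rw [hA.isHermitian.spectrum_real_eq_range_eigenvalues] at ht
  obtain ⟨i, rfl⟩ := ht
  exact hA.eigenvalues_pos i

lemma cfc_exp_mLog {d : ℕ} {A : Matrix (Fin d) (Fin d) ℂ} (hA : A.PosDef) :
    cfc Real.exp (mLog A) = A := by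
  have hsa : IsSelfAdjoint A := hA.isHermitian
  rw [mLog_eq_cfc hA.isHermitian, ← cfc_comp Real.exp Real.log A hsa
    ((A.finite_real_spectrum.image _).continuousOn _) (A.continuousOn_real_spectrum _)]
  conv_rhs => rw [← cfc_id ℝ A hsa]
  exact cfc_congr fun t ht ↦ Real.exp_log (hA.pos_of_mem_spectrum ht)

lemma isHermitian_cfc {d : ℕ} (f : ℝ → ℝ) (A : Matrix (Fin d) (Fin d) ℂ) :
    (cfc f A).IsHermitian :=
  cfc_predicate f A

lemma mLog_cfc_exp {d : ℕ} {L : Matrix (Fin d) (Fin d) ℂ} (hL : L.IsHermitian) :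
    mLog (cfc Real.exp L) = L := by
  have hsa : IsSelfAdjoint L := hL
  rw [mLog_eq_cfc (isHermitian_cfc _ _), ← cfc_comp Real.log Real.exp L hsa
    ((L.finite_real_spectrum.image _).continuousOn _) (L.continuousOn_real_spectrum _)]
  conv_rhs => rw [← cfc_id ℝ L hsa]
  exact cfc_congr fun t _ ↦ Real.log_exp t

lemma posDef_cfc_exp {d : ℕ} {L : Matrix (Fin d) (Fin d) ℂ} (hL : L.IsHermitian) :
    (cfc Real.exp L).PosDef := by
  have hsa : IsSelfAdjoint L := hL
  rw [(isHermitian_cfc _ _).posDef_iff_eigenvalues_pos]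
  intro i
  have h := (isHermitian_cfc Real.exp L).eigenvalues_mem_spectrum_real i
  rw [cfc_map_spectrum Real.exp L hsa (L.continuousOn_real_spectrum _)] at h
  obtain ⟨t, -, ht⟩ := h
  rw [← ht]
  exact Real.exp_pos t

lemma mLog_injOn_posDef {d : ℕ} {A B : Matrix (Fin d) (Fin d) ℂ} (hA : A.PosDef) (hB : B.PosDef)
    (h : mLog A = mLog B) : A = B := by
  rw [← cfc_exp_mLog hA, h, cfc_exp_mLog hB]

lemma mLog_smul {d : ℕ} {A : Matrix (Fin d) (Fin d) ℂ} (hA : A.PosDef) {r : ℝ} (hr : 0 < r) :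
    mLog (r • A) = Real.log r • (1 : Matrix (Fin d) (Fin d) ℂ) + mLog A := by
  have hsa : IsSelfAdjoint A := hA.isHermitian
  rw [mLog_eq_cfc (hA.smul hr).isHermitian, mLog_eq_cfc hA.isHermitian,
    ← cfc_const_mul_id r A hsa, ← cfc_comp Real.log (r * ·) A hsa
    ((A.finite_real_spectrum.image _).continuousOn _) (A.continuousOn_real_spectrum _),
    ← Algebra.algebraMap_eq_smul_one, ← cfc_const_add _ _ _ (A.continuousOn_real_spectrum _) hsa]
  exact cfc_congr fun t ht ↦ Real.log_mul hr.ne' (hA.pos_of_mem_spectrum ht).ne'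

lemma Matrix.PosDef.trace_eq_ofReal_pos {d : ℕ} (hd : 0 < d) {A : Matrix (Fin d) (Fin d) ℂ}
    (hA : A.PosDef) : ∃ p : ℝ, 0 < p ∧ A.trace = p := by
  have : Nonempty (Fin d) := ⟨⟨0, hd⟩⟩
  obtain ⟨hre, him⟩ := Complex.pos_iff.1 hA.trace_pos
  exact ⟨A.trace.re, hre, Complex.ext rfl him.symm⟩

/-- under Condition (D), there is exactly one positive definite density
matrix `σ` for which all the relative entropies `D(W_x‖σ)` coincide. -/
theorem stmt8 {d : ℕ} (hd : 0 < d)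
    (W : Fin (d ^ 2) → Matrix (Fin d) (Fin d) ℂ)
    (hWpd : ∀ i, (W i).PosDef) (hWtr : ∀ i, (W i).trace = 1)
    (hWli : LinearIndependent ℝ W) :
    ∃! σ : Matrix (Fin d) (Fin d) ℂ,
      σ.PosDef ∧ σ.trace = 1 ∧
        ∀ x x', qRel (W x) σ = qRel (W x') σ := by
  have hW (x) : (W x).IsHermitian := (hWpd x).isHermitian
  have hli := linearIndependent_complex_of_isHermitian hW hWli
  obtain ⟨L, hL, hWL⟩ :=
    exists_isHermitian_trace_mul_eq hW hli fun x ↦ (W x * mLog (W x)).trace.re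
  have hE := posDef_cfc_exp hL
  have hlogE := mLog_cfc_exp hL
  generalize cfc Real.exp L = E at hE hlogE
  obtain ⟨p, hp, hEp⟩ := hE.trace_eq_ofReal_pos hd
  refine ⟨p⁻¹ • E, ⟨hE.smul (inv_pos.2 hp), ?_, fun x x' ↦ ?_⟩, ?_⟩
  · rw [Matrix.trace_smul, hEp, Complex.real_smul, Complex.ofReal_inv,
      inv_mul_cancel₀ (Complex.ofReal_ne_zero.2 hp.ne')]
  · have key (y) : qRel (W y) (p⁻¹ • E) = -Real.log p⁻¹ := by
      rw [qRel, mLog_smul hE (inv_pos.2 hp), hlogE, Matrix.mul_sub, Matrix.mul_add,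
        Matrix.mul_smul, Matrix.mul_one, Matrix.trace_sub, Matrix.trace_add, Matrix.trace_smul,
        hWtr, hWL]
      simp
    rw [key, key]
  · rintro σ ⟨hσ, hσtr, hσeq⟩
    let x₀ : Fin (d ^ 2) := ⟨0, by positivity⟩
    have hσE : σ = Real.exp (-qRel (W x₀) σ) • E := by
      refine mLog_injOn_posDef hσ (hE.smul (Real.exp_pos _)) ?_
      rw [mLog_smul hE (Real.exp_pos _), Real.log_exp, hlogE, ← sub_eq_zero]
      refine eq_zero_of_trace_mul_eq_zero hli fun x ↦ ?_
      have hreal : (W x * mLog σ).trace = (W x * mLog σ).trace.re :=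
        (Complex.conj_eq_iff_re.1 (star_trace_mul_of_isHermitian (hW x)
          (isHermitian_mLog hσ.isHermitian))).symm
      rw [Matrix.mul_sub, Matrix.mul_add, Matrix.mul_smul, Matrix.mul_one, Matrix.trace_sub,
        Matrix.trace_add, Matrix.trace_smul, hWtr, hWL, hreal, hσeq x₀ x, qRel, Matrix.mul_sub,
        Matrix.trace_sub, Complex.sub_re, Complex.real_smul]
      push_cast
      ring
    generalize Real.exp (-qRel (W x₀) σ) = r at hσE
    rw [hσE, Matrix.trace_smul, hEp, Complex.real_smul, ← Complex.ofReal_mul,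
      Complex.ofReal_eq_one] at hσtr
    rw [hσE, eq_inv_of_mul_eq_one_left hσtr]
end

section
/- Let P be a probability distribution with full support on a finite set Z and let f be a real-valued function on Z. For t ∈ ℝ define φ(t) = log ∑_{z∈Z} P(z) e^{t f(z)} and the distribution P_t(z) = P(z) e^{t f(z) − φ(t)}. Then for all real numbers t₁ ≤ t₂ ≤ t₃, D(P_{t₁}‖P_{t₂}) + D(P_{t₂}‖P_{t₃}) ≤ D(P_{t₁}‖P_{t₃}). -/
open Real Finset

/-- The one-parameter exponential family `P_t(z) = P(z) e^{t f(z) − φ(t)}` with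
`φ(t) = log ∑_z P(z) e^{t f(z)}`. -/
noncomputable def expCurve {α : Type*} [Fintype α] (P : α → ℝ) (f : α → ℝ)
    (t : ℝ) : α → ℝ :=
  fun z => P z * Real.exp (t * f z - Real.log (∑ w, P w * Real.exp (t * f w)))

lemma expCurve_pos {α : Type*} [Fintype α] {P : α → ℝ} (hP : ∀ z, 0 < P z) (f : α → ℝ)
    (t : ℝ) (z : α) : 0 < expCurve P f t z :=
  mul_pos (hP z) (exp_pos _)

lemma sum_expCurve {α : Type*} [Fintype α] [Nonempty α] {P : α → ℝ} (hP : ∀ z, 0 < P z)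
    (f : α → ℝ) (t : ℝ) : ∑ z, expCurve P f t z = 1 := by
  have hZ : 0 < ∑ w, P w * exp (t * f w) :=
    sum_pos (fun w _ => mul_pos (hP w) (exp_pos _)) univ_nonempty
  simp only [expCurve, exp_sub, exp_log hZ, ← mul_div_assoc, ← sum_div]
  exact div_self hZ.ne'

/-- The log-likelihood ratio of two members of an exponential family is affine in `f`. -/
lemma log_expCurve_div {α : Type*} [Fintype α] {P : α → ℝ} (hP : ∀ z, 0 < P z) (f : α → ℝ)
    (s t : ℝ) (z : α) :
    log (expCurve P f s z / expCurve P f t z) =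
      (s - t) * f z + (log (∑ w, P w * exp (t * f w)) - log (∑ w, P w * exp (s * f w))) := by
  simp only [expCurve]
  rw [mul_div_mul_left _ _ (hP z).ne', ← exp_sub, log_exp]
  ring

lemma KL_expCurve {α : Type*} [Fintype α] [Nonempty α] {P : α → ℝ} (hP : ∀ z, 0 < P z)
    (f : α → ℝ) (s t : ℝ) :
    KL (expCurve P f s) (expCurve P f t) =
      (s - t) * ∑ z, expCurve P f s z * f z +
        (log (∑ w, P w * exp (t * f w)) - log (∑ w, P w * exp (s * f w))) := by
  simp only [KL, log_expCurve_div hP, mul_add, sum_add_distrib, ← sum_mul, sum_expCurve hP,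
    one_mul, mul_sum, mul_left_comm]

/-- The symmetrized divergence is nonnegative. -/
lemma KL_add_KL_swap_nonneg {α : Type*} [Fintype α] {p q : α → ℝ} (hp : ∀ z, 0 < p z)
    (hq : ∀ z, 0 < q z) : 0 ≤ KL p q + KL q p := by
  rw [KL, KL, ← sum_add_distrib]
  refine sum_nonneg fun z _ => ?_
  rw [log_div (hp z).ne' (hq z).ne', log_div (hq z).ne' (hp z).ne']
  rcases le_total (p z) (q z) with h | h
  · nlinarith [log_le_log (hp z) h]
  · nlinarith [log_le_log (hq z) h]

/-- The mean of `f` is nondecreasing along the exponential family it generates. -/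
lemma monotone_sum_expCurve_mul {α : Type*} [Fintype α] [Nonempty α] {P : α → ℝ}
    (hP : ∀ z, 0 < P z) (f : α → ℝ) : Monotone fun t => ∑ z, expCurve P f t z * f z := by
  intro s t hst
  rcases hst.eq_or_lt with rfl | hlt
  · exact le_rfl
  have h := KL_add_KL_swap_nonneg (expCurve_pos hP f s) (expCurve_pos hP f t)
  rw [KL_expCurve hP, KL_expCurve hP] at h
  dsimp only
  nlinarith

/-- along a one-parameter exponential family,
`D(P_{t₁}‖P_{t₂}) + D(P_{t₂}‖P_{t₃}) ≤ D(P_{t₁}‖P_{t₃})` for `t₁ ≤ t₂ ≤ t₃`. -/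
theorem stmt9 {Z : Type*} [Fintype Z] (P : Z → ℝ)
    (hP : ∀ z, 0 < P z) (hPsum : ∑ z, P z = 1) (f : Z → ℝ) :
    ∀ t₁ t₂ t₃ : ℝ, t₁ ≤ t₂ → t₂ ≤ t₃ →
      KL (expCurve P f t₁) (expCurve P f t₂) + KL (expCurve P f t₂) (expCurve P f t₃)
        ≤ KL (expCurve P f t₁) (expCurve P f t₃) := by
  intro t₁ t₂ t₃ h₁₂ h₂₃
  have : Nonempty Z := by
    by_contra h
    rw [not_nonempty_iff] at h
    simp at hPsum
  have hm := monotone_sum_expCurve_mul hP f h₁₂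
  dsimp only at hm
  simp only [KL_expCurve hP]
  nlinarith [mul_nonneg (sub_nonneg.2 h₂₃) (sub_nonneg.2 hm)]
end

section
/- Let P be a full-support probability distribution on a finite set Z, let f_1,…,f_l be real-valued functions on Z, let E = { P_θ : θ ∈ ℝ^l } where P_θ(z) = P(z) exp(∑_{j=1}^l θ^j f_j(z) − φ(θ)) and φ(θ) = log ∑_{z∈Z} P(z) exp(∑_{j=1}^l θ^j f_j(z)), and let M = { Q a probability distribution on Z : ∑_{z∈Z} f_j(z) Q(z) = a_j for j = 1,…,l } for fixed reals a_1,…,a_l. Then every P_* ∈ E ∩ M satisfies the Pythagorean identity D(P₁‖P₂) = D(P₁‖P_*) + D(P_*‖P₂) for all P₁ ∈ M and P₂ ∈ E; consequently E ∩ M contains at most one element. -/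
open Real Finset

/-- Member `P_θ` of the exponential family with base `P` generated by `f_1,…,f_l`:
`P_θ(z) = P(z) exp(∑_j θ^j f_j(z) − φ(θ))` with
`φ(θ) = log ∑_z P(z) exp(∑_j θ^j f_j(z))`. -/
noncomputable def expFam {α ι : Type*} [Fintype α] [Fintype ι]
    (P : α → ℝ) (f : ι → α → ℝ) (θ : ι → ℝ) : α → ℝ :=
  fun z => P z * Real.exp (∑ j, θ j * f j z -
    Real.log (∑ w, P w * Real.exp (∑ j, θ j * f j w)))

theorem expFam_pos {α ι : Type*} [Fintype α] [Fintype ι] {P : α → ℝ}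
    (hP : ∀ z, 0 < P z) (f : ι → α → ℝ) (θ : ι → ℝ) (z : α) : 0 < expFam P f θ z :=
  mul_pos (hP z) (Real.exp_pos _)

/-- Log-likelihood ratios within an exponential family are affine in the generators. -/
theorem exists_log_expFam_sub_log_expFam {α ι : Type*} [Fintype α] [Fintype ι] {P : α → ℝ}
    (hP : ∀ z, 0 < P z) (f : ι → α → ℝ) (θ η : ι → ℝ) :
    ∃ c : ℝ, ∀ z, Real.log (expFam P f θ z) - Real.log (expFam P f η z) =
      ∑ j, (θ j - η j) * f j z + c := by
  refine ⟨Real.log (∑ w, P w * Real.exp (∑ j, η j * f j w)) -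
    Real.log (∑ w, P w * Real.exp (∑ j, θ j * f j w)), fun z => ?_⟩
  unfold expFam
  rw [Real.log_mul (hP z).ne' (Real.exp_pos _).ne', Real.log_mul (hP z).ne' (Real.exp_pos _).ne',
    Real.log_exp, Real.log_exp]
  simp only [sub_mul, Finset.sum_sub_distrib]
  ring

/-- An affine combination of the `f j` has the same expectation under all distributions of a
mixture family. -/
theorem IsDist.sum_mul_affine {α ι : Type*} [Fintype α] [Fintype ι] {f : ι → α → ℝ} {a : ι → ℝ}
    {Q : α → ℝ} (hQ : IsDist Q) (hQa : ∀ j, ∑ z, f j z * Q z = a j) (t : ι → ℝ) (c : ℝ) :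
    ∑ z, Q z * (∑ j, t j * f j z + c) = ∑ j, t j * a j + c := by
  simp only [mul_add, Finset.sum_add_distrib, ← Finset.sum_mul, hQ.2, one_mul, Finset.mul_sum]
  rw [Finset.sum_comm]
  simp only [← hQa, Finset.mul_sum]
  congr 1
  exact Finset.sum_congr rfl fun j _ => Finset.sum_congr rfl fun z _ => by ring

theorem KL_eq_sum_mul_log_sub_log {α : Type*} [Fintype α] {p q : α → ℝ} (hq : ∀ z, 0 < q z) :
    KL p q = ∑ z, p z * (Real.log (p z) - Real.log (q z)) := by
  refine Finset.sum_congr rfl fun z _ => ?_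
  by_cases hp : p z = 0
  · simp [hp]
  · rw [Real.log_div hp (hq z).ne']

theorem sub_mul_log_sub_log_pos {x y : ℝ} (hx : 0 < x) (hy : 0 < y) (hxy : x ≠ y) :
    0 < (x - y) * (Real.log x - Real.log y) := by
  rcases lt_or_gt_of_ne hxy with h | h
  · exact mul_pos_of_neg_of_neg (sub_neg.2 h) (sub_neg.2 (Real.log_lt_log hx h))
  · exact mul_pos (sub_pos.2 h) (sub_pos.2 (Real.log_lt_log hy h))

/-- Log-likelihood ratios within an exponential family have the same expectation under any two
distributions of the mixture family. -/
theorem sum_mul_log_expFam_sub_eq {α ι : Type*} [Fintype α] [Fintype ι] {P : α → ℝ}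
    (hP : ∀ z, 0 < P z) {f : ι → α → ℝ} {a : ι → ℝ} {Q R : α → ℝ}
    (hQ : IsDist Q ∧ ∀ j, ∑ z, f j z * Q z = a j)
    (hR : IsDist R ∧ ∀ j, ∑ z, f j z * R z = a j) (θ η : ι → ℝ) :
    ∑ z, Q z * (Real.log (expFam P f θ z) - Real.log (expFam P f η z)) =
      ∑ z, R z * (Real.log (expFam P f θ z) - Real.log (expFam P f η z)) := by
  obtain ⟨c, hc⟩ := exists_log_expFam_sub_log_expFam hP f θ η
  simp only [hc]
  rw [hQ.1.sum_mul_affine hQ.2, hR.1.sum_mul_affine hR.2]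

/-- every element of the intersection of the exponential family `E`
and the mixture family `M` satisfies the Pythagorean identity, and consequently
`E ∩ M` has at most one element. -/
theorem stmt10 {Z : Type*} [Fintype Z] {l : ℕ} (P : Z → ℝ)
    (hP : ∀ z, 0 < P z) (hPsum : ∑ z, P z = 1)
    (f : Fin l → Z → ℝ) (a : Fin l → ℝ) :
    (∀ Pstar : Z → ℝ, (∃ θ : Fin l → ℝ, Pstar = expFam P f θ) →
      (IsDist Pstar ∧ ∀ j, ∑ z, f j z * Pstar z = a j) →
      ∀ P₁ : Z → ℝ, (IsDist P₁ ∧ ∀ j, ∑ z, f j z * P₁ z = a j) →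
      ∀ P₂ : Z → ℝ, (∃ θ : Fin l → ℝ, P₂ = expFam P f θ) →
        KL P₁ P₂ = KL P₁ Pstar + KL Pstar P₂)
    ∧ Set.Subsingleton {Q : Z → ℝ | (∃ θ : Fin l → ℝ, Q = expFam P f θ) ∧
        IsDist Q ∧ ∀ j, ∑ z, f j z * Q z = a j} := by
  constructor
  · rintro _ ⟨θ, rfl⟩ hstar P₁ h₁ _ ⟨η, rfl⟩
    rw [KL_eq_sum_mul_log_sub_log (expFam_pos hP f η), KL_eq_sum_mul_log_sub_log (expFam_pos hP f η),
      KL_eq_sum_mul_log_sub_log (expFam_pos hP f θ), sum_mul_log_expFam_sub_eq hP hstar h₁,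
      ← Finset.sum_add_distrib]
    exact Finset.sum_congr rfl fun z _ => by ring
  · rintro _ ⟨⟨θ, rfl⟩, hQ⟩ _ ⟨⟨η, rfl⟩, hR⟩
    have hsum : ∑ z, (expFam P f θ z - expFam P f η z) *
        (Real.log (expFam P f θ z) - Real.log (expFam P f η z)) = 0 := by
      simp only [sub_mul (expFam P f θ _), Finset.sum_sub_distrib]
      exact sub_eq_zero.2 (sum_mul_log_expFam_sub_eq hP hQ hR θ η)
    have hpos : ∀ z, expFam P f θ z ≠ expFam P f η z → 0 < (expFam P f θ z - expFam P f η z) *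
        (Real.log (expFam P f θ z) - Real.log (expFam P f η z)) := fun z =>
      sub_mul_log_sub_log_pos (expFam_pos hP f θ z) (expFam_pos hP f η z)
    ext z
    by_contra hz
    refine (hpos z hz).ne' ((Finset.sum_eq_zero_iff_of_nonneg fun w _ => ?_).1 hsum z
      (Finset.mem_univ z))
    by_cases hw : expFam P f θ w = expFam P f η w
    · simp [hw]
    · exact (hpos w hw).le
end

section
/- Let f_1,…,f_l be real-valued functions on a finite set Z, let M = { Q a probability distribution on Z : ∑_{z∈Z} f_j(z) Q(z) = a_j for j = 1,…,l } for fixed reals a_1,…,a_l, assume M is nonempty, and let Q_Z be a full-support probability distribution on Z. Then there exists a unique distribution Q_* ∈ M such that D(P₁‖Q_Z) = D(P₁‖Q_*) + D(Q_*‖Q_Z) for every P₁ ∈ M. -/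
open Real Finset

/-- The mixture family determined by the constraints `∑ z, f j z * Q z = a j`. -/
def mixtureFamily {Z ι : Type*} [Fintype Z] (f : ι → Z → ℝ) (a : ι → ℝ) : Set (Z → ℝ) :=
  {Q | IsDist Q ∧ ∀ j, ∑ z, f j z * Q z = a j}

section Projection

variable {Z ι : Type*} [Fintype Z] {f : ι → Z → ℝ} {a : ι → ℝ} {P Q R : Z → ℝ}

lemma lineMap_mem_mixtureFamily (hR : R ∈ mixtureFamily f a) (hP : P ∈ mixtureFamily f a)
    {t : ℝ} (h : ∀ z, 0 ≤ R z + t * (P z - R z)) :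
    (fun z => R z + t * (P z - R z)) ∈ mixtureFamily f a := by
  refine ⟨⟨h, ?_⟩, fun j => ?_⟩
  · simp only [sum_add_distrib, ← mul_sum, sum_sub_distrib, hR.1.2, hP.1.2]
    ring
  · have hsum : ∑ z, f j z * (R z + t * (P z - R z))
        = ∑ z, f j z * R z + t * (∑ z, f j z * P z - ∑ z, f j z * R z) := by
      rw [← sum_sub_distrib, mul_sum, ← sum_add_distrib]
      exact sum_congr rfl fun z _ => by ring
    rw [hsum, hR.2, hP.2]
    ring

lemma segment_mem_mixtureFamily (hR : R ∈ mixtureFamily f a) (hP : P ∈ mixtureFamily f a)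
    {t : ℝ} (h0 : 0 ≤ t) (h1 : t ≤ 1) :
    (fun z => R z + t * (P z - R z)) ∈ mixtureFamily f a :=
  lineMap_mem_mixtureFamily hR hP fun z => by
    nlinarith [mul_nonneg (sub_nonneg.2 h1) (hR.1.1 z), mul_nonneg h0 (hP.1.1 z)]

lemma isCompact_mixtureFamily : IsCompact (mixtureFamily f a) := by
  have h : mixtureFamily f a = stdSimplex ℝ Z ∩ {Q | ∀ j, ∑ z, f j z * Q z = a j} := rfl
  rw [h, Set.ofPred_forall]
  exact (isCompact_stdSimplex ℝ Z).inter_right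
    (isClosed_iInter fun j => isClosed_eq (by fun_prop) continuous_const)

lemma mul_log_div {x q : ℝ} (hq : 0 < q) :
    x * Real.log (x / q) = x * Real.log x - x * Real.log q := by
  rcases eq_or_ne x 0 with rfl | hx
  · simp
  · rw [Real.log_div hx hq.ne']
    ring

lemma KL_eq_sum_sub (hQ : ∀ z, 0 < Q z) (P : Z → ℝ) :
    KL P Q = ∑ z, (P z * Real.log (P z) - P z * Real.log (Q z)) :=
  sum_congr rfl fun z _ => mul_log_div (hQ z)

lemma continuous_KL_left (hQ : ∀ z, 0 < Q z) : Continuous fun P : Z → ℝ => KL P Q := by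
  simp only [KL_eq_sum_sub hQ]
  exact continuous_finsetSum _ fun z _ =>
    (Real.continuous_mul_log.comp (continuous_apply z)).sub (by fun_prop)

/-- Convexity of the divergence along a segment, with the additional entropy gained on the points
outside the support of the starting distribution. -/
lemma KL_segment_le (hQ : ∀ z, 0 < Q z) (hR : ∀ z, 0 ≤ R z) (hP : ∀ z, 0 ≤ P z)
    {t : ℝ} (h0 : 0 < t) (h1 : t ≤ 1) :
    KL (fun z => R z + t * (P z - R z)) Q ≤
      (1 - t) * KL R Q + t * KL P Q + t * Real.log t * ∑ z with R z = 0, P z := by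
  simp only [KL_eq_sum_sub hQ, sum_filter, mul_sum, ← sum_add_distrib]
  refine sum_le_sum fun z _ => ?_
  split_ifs with hz
  · rcases eq_or_ne (P z) 0 with hp | hp
    · simp [hz, hp]
    · simp only [hz, sub_zero, zero_add, Real.log_mul h0.ne' hp]
      apply le_of_eq
      ring
  · have h := Real.convexOn_mul_log.2 (hR z) (hP z) (sub_nonneg.2 h1) h0.le (by ring)
    simp only [smul_eq_mul] at h
    rw [show (1 - t) * R z + t * P z = R z + t * (P z - R z) by ring] at h
    linarith

/-- A minimizer of the divergence dominates the whole mixture family. -/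
lemma support_subset_of_isMinOn (hQ : ∀ z, 0 < Q z) (hR : R ∈ mixtureFamily f a)
    (hmin : IsMinOn (fun P => KL P Q) (mixtureFamily f a) R) (hP : P ∈ mixtureFamily f a)
    {z : Z} (hz : R z = 0) : P z = 0 := by
  set c := ∑ z with R z = 0, P z with hc
  have hc0 : 0 ≤ c := sum_nonneg fun z _ => hP.1.1 z
  suffices h : c = 0 from
    (sum_eq_zero_iff_of_nonneg fun z _ => hP.1.1 z).1 h z (by simp [hz])
  by_contra hne
  have hpos : 0 < c := lt_of_le_of_ne hc0 (Ne.symm hne)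
  have hg : 0 ≤ KL P Q - KL R Q := sub_nonneg.2 (hmin hP)
  set t := Real.exp (-((KL P Q - KL R Q + 1) / c)) with ht
  have ht0 : 0 < t := Real.exp_pos _
  have ht1 : t ≤ 1 := Real.exp_le_one_iff.2 (neg_nonpos.2 (by positivity))
  have h1 : KL R Q ≤ KL (fun z => R z + t * (P z - R z)) Q :=
    hmin (segment_mem_mixtureFamily hR hP ht0.le ht1)
  have h2 := KL_segment_le hQ hR.1.1 hP.1.1 ht0 ht1
  have h3 : t * Real.log t * c = -(t * (KL P Q - KL R Q + 1)) := by
    rw [ht, Real.log_exp]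
    field_simp
  rw [← hc, h3] at h2
  linarith

/-- First-order condition at a minimizer of the divergence. -/
lemma sum_sub_mul_log_eq_zero_of_isMinOn (hQ : ∀ z, 0 < Q z) (hR : R ∈ mixtureFamily f a)
    (hmin : IsMinOn (fun P => KL P Q) (mixtureFamily f a) R) (hP : P ∈ mixtureFamily f a) :
    ∑ z, (P z - R z) * (Real.log (R z) - Real.log (Q z)) = 0 := by
  have hsupp : ∀ z, R z = 0 → P z = 0 := fun z => support_subset_of_isMinOn hQ hR hmin hP
  have hline : ∀ z, HasDerivAt (fun t : ℝ => R z + t * (P z - R z)) (P z - R z) 0 := fun z => by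
    simpa using ((hasDerivAt_id (0 : ℝ)).mul_const (P z - R z)).const_add (R z)
  have hderiv : HasDerivAt (fun t : ℝ => KL (fun z => R z + t * (P z - R z)) Q)
      (∑ z, (P z - R z) * (Real.log (R z) + 1 - Real.log (Q z))) 0 := by
    simp only [KL_eq_sum_sub hQ]
    refine HasDerivAt.fun_sum fun z _ => ?_
    by_cases hz : R z = 0
    · simpa [hz, hsupp z hz] using hasDerivAt_const (0 : ℝ) (0 : ℝ)
    · have h := Real.hasDerivAt_mul_log (x := R z + 0 * (P z - R z)) (by simpa using hz)
      have h' := (h.comp (0 : ℝ) (hline z)).sub ((hline z).mul_const (Real.log (Q z)))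
      refine h'.congr_deriv ?_
      rw [zero_mul, add_zero]
      ring
  have hloc : IsLocalMin (fun t : ℝ => KL (fun z => R z + t * (P z - R z)) Q) 0 := by
    have hev : ∀ᶠ t : ℝ in nhds 0, ∀ z, 0 ≤ R z + t * (P z - R z) := by
      refine Filter.eventually_all.2 fun z => ?_
      by_cases hz : R z = 0
      · simp [hz, hsupp z hz]
      · have hpos : 0 < R z + 0 * (P z - R z) := by
          simpa using lt_of_le_of_ne (hR.1.1 z) (Ne.symm hz)
        exact ((hline z).continuousAt.eventually (lt_mem_nhds hpos)).mono fun t ht => ht.le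
    filter_upwards [hev] with t ht
    simpa using hmin (lineMap_mem_mixtureFamily hR hP ht)
  have h := hloc.hasDerivAt_eq_zero hderiv
  have hsum : ∑ z, (P z - R z) = 0 := by rw [sum_sub_distrib, hP.1.2, hR.1.2, sub_self]
  rw [← h, ← sub_eq_zero, ← sum_sub_distrib, ← neg_eq_zero, ← sum_neg_distrib, ← hsum]
  exact sum_congr rfl fun z _ => by ring

/-- The Pythagorean identity for a minimizer of the divergence. -/
lemma KL_eq_add_of_isMinOn (hQ : ∀ z, 0 < Q z) (hR : R ∈ mixtureFamily f a)
    (hmin : IsMinOn (fun P => KL P Q) (mixtureFamily f a) R) (hP : P ∈ mixtureFamily f a) :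
    KL P Q = KL P R + KL R Q := by
  rw [← sub_eq_zero, ← sum_sub_mul_log_eq_zero_of_isMinOn hQ hR hmin hP, KL_eq_sum_sub hQ,
    KL_eq_sum_sub hQ, KL, ← sum_add_distrib, ← sum_sub_distrib]
  refine sum_congr rfl fun z _ => ?_
  rcases (hR.1.1 z).eq_or_lt' with hz | hz
  · simp [hz, support_subset_of_isMinOn hQ hR hmin hP hz]
  · rw [mul_log_div hz]
    ring

/-- A distribution satisfying the Pythagorean identity dominates the whole mixture family, even
though the real-valued `KL` ignores the points outside the support of its second argument. -/
lemma support_subset_of_KL_eq_add (hQ : ∀ z, 0 < Q z) (hR : R ∈ mixtureFamily f a)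
    (h : ∀ P ∈ mixtureFamily f a, KL P Q = KL P R + KL R Q) (hP : P ∈ mixtureFamily f a)
    {z : Z} (hz : R z = 0) : P z = 0 := by
  have hM := segment_mem_mixtureFamily hR hP (t := 1 / 2) (by norm_num) (by norm_num)
  set S : Z → ℝ := fun z => R z + 1 / 2 * (P z - R z) with hS
  have key : (KL S Q - KL S R) - ((KL R Q - KL R R) + (KL P Q - KL P R)) / 2
      = -(Real.log 2 / 2) * ∑ z with R z = 0, P z := by
    simp only [KL_eq_sum_sub hQ]
    simp only [KL, sum_filter, mul_sum, ← sum_sub_distrib, ← sum_add_distrib, sum_div]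
    refine sum_congr rfl fun z _ => ?_
    rcases (hR.1.1 z).eq_or_lt' with hz | hz
    · rcases eq_or_ne (P z) 0 with hp | hp
      · simp [hS, hz, hp]
      · simp only [hS, hz, sub_zero, zero_add, Real.log_mul (by norm_num : (1 / 2 : ℝ) ≠ 0) hp]
        simp
        ring
    · simp only [mul_log_div hz, hz.ne', if_false, hS]
      ring
  have hc : ∑ z with R z = 0, P z = 0 := by
    have h2 : Real.log 2 ≠ 0 := (Real.log_pos one_lt_two).ne'
    have h0 : -(Real.log 2 / 2) * ∑ z with R z = 0, P z = 0 := by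
      linarith [h S hM, h R hR, h P hP]
    simpa [h2] using h0
  exact (sum_eq_zero_iff_of_nonneg fun z _ => hP.1.1 z).1 hc z (by simp [hz])

lemma eq_of_KL_add_KL_eq_zero (hP : ∀ z, 0 ≤ P z) (hR : ∀ z, 0 ≤ R z)
    (hsupp : ∀ z, P z = 0 ↔ R z = 0) (h : KL P R + KL R P = 0) : P = R := by
  have hterm : ∀ z, 0 ≤ P z * Real.log (P z / R z) + R z * Real.log (R z / P z) ∧
      (P z * Real.log (P z / R z) + R z * Real.log (R z / P z) = 0 → P z = R z) := fun z => by
    rcases (hP z).eq_or_lt' with hz | hz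
    · simp [hz, (hsupp z).1 hz]
    · have hz' : 0 < R z := lt_of_le_of_ne (hR z) fun h => hz.ne' ((hsupp z).2 h.symm)
      rw [mul_log_div hz, mul_log_div hz']
      rcases lt_trichotomy (P z) (R z) with hlt | heq | hlt
      · have := mul_pos (sub_pos.2 hlt) (sub_pos.2 (Real.log_lt_log hz hlt))
        exact ⟨by linarith, fun _ => by linarith⟩
      · simp [heq]
      · have := mul_pos (sub_pos.2 hlt) (sub_pos.2 (Real.log_lt_log hz' hlt))
        exact ⟨by linarith, fun _ => by linarith⟩
  rw [KL, KL, ← sum_add_distrib, sum_eq_zero_iff_of_nonneg fun z _ => (hterm z).1] at h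
  exact funext fun z => (hterm z).2 (h z (mem_univ z))

end Projection

/-- the m-projection of a full-support distribution `Q_Z` onto a
nonempty mixture family `M` exists and is unique: there is a unique `Q_* ∈ M`
with `D(P₁‖Q_Z) = D(P₁‖Q_*) + D(Q_*‖Q_Z)` for every `P₁ ∈ M`. -/
theorem stmt11 {Z : Type*} [Fintype Z] {l : ℕ}
    (f : Fin l → Z → ℝ) (a : Fin l → ℝ)
    (hM : ∃ Q : Z → ℝ, IsDist Q ∧ ∀ j, ∑ z, f j z * Q z = a j)
    (QZ : Z → ℝ) (hQZ : IsDist QZ) (hfull : ∀ z, 0 < QZ z) :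
    ∃! Qstar : Z → ℝ,
      (IsDist Qstar ∧ ∀ j, ∑ z, f j z * Qstar z = a j) ∧
      ∀ P₁ : Z → ℝ, (IsDist P₁ ∧ ∀ j, ∑ z, f j z * P₁ z = a j) →
        KL P₁ QZ = KL P₁ Qstar + KL Qstar QZ := by
  obtain ⟨R, hR, hmin⟩ := isCompact_mixtureFamily.exists_isMinOn
    (s := mixtureFamily f a) hM (continuous_KL_left hfull).continuousOn
  have hpyth : ∀ P ∈ mixtureFamily f a, KL P QZ = KL P R + KL R QZ :=
    fun P hP => KL_eq_add_of_isMinOn hfull hR hmin hP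
  refine ⟨R, ⟨hR, hpyth⟩, fun S hS => ?_⟩
  refine eq_of_KL_add_KL_eq_zero hS.1.1.1 hR.1.1
    (fun z => ⟨support_subset_of_KL_eq_add hfull hS.1 hS.2 hR,
      support_subset_of_KL_eq_add hfull hR hpyth hS.1⟩) ?_
  linarith [hpyth S hS.1, hS.2 R hR]
end

section
/- Let ε ∈ (0, 1/2] and consider the channel with input alphabet X = {1,2,3} and output alphabet Y = {1,2,3} given by W_1 = (1−ε, 0, ε), W_2 = (0, 1−ε, ε), W_3 = (1/2, 1/2, 0). Set h₄ = log 2 − h(ε). If ((1−ε)/(2ε))·exp(h₄/ε) ≤ 1, then the capacity of this channel equals log(1 + exp(h₄/ε)/2). -/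
open Real Finset

/-- Binary entropy `h(t) = −t log t − (1−t) log(1−t)` (natural log). -/
noncomputable def bent (t : ℝ) : ℝ :=
  -(t * Real.log t) - (1 - t) * Real.log (1 - t)

/-- Bounding the logarithm of a likelihood ratio after changing the reference value. -/
theorem mul_log_div_le_mul_log_div_add {a w r s : ℝ} (ha : 0 ≤ a) (hw : 0 ≤ w)
    (hr : 0 < r) (hs : 0 < s) :
    a * (w * Real.log (w / r)) ≤ a * (w * Real.log (w / s)) + a * w * (s / r - 1) := by
  rcases hw.eq_or_lt with rfl | hw
  · simp
  have h := Real.log_le_sub_one_of_pos (div_pos hs hr)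
  have h2 : Real.log (w / r) = Real.log (w / s) + Real.log (s / r) := by
    rw [Real.log_div hw.ne' hr.ne', Real.log_div hw.ne' hs.ne', Real.log_div hs.ne' hr.ne']
    ring
  rw [h2]
  nlinarith [mul_le_mul_of_nonneg_left h (mul_nonneg ha hw.le)]

/-- The output distribution of a channel is a probability distribution. -/
theorem IsDist.output {α β : Type*} [Fintype α] [Fintype β] {W : α → β → ℝ}
    (hW : ∀ x, IsDist (W x)) {q : α → ℝ} (hq : IsDist q) : IsDist (output W q) := by
  refine ⟨fun y => Finset.sum_nonneg fun x _ => mul_nonneg (hq.1 x) ((hW x).1 y), ?_⟩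
  simp only [_root_.output]
  rw [Finset.sum_comm]
  simp [← Finset.mul_sum, (hW _).2, hq.2]

/-- Mutual information is at most the averaged divergence from any positive output law. -/
theorem mutInfo_le_sum_mul_KL {α β : Type*} [Fintype α] [Fintype β] {W : α → β → ℝ}
    (hW : ∀ x, IsDist (W x)) {q : α → ℝ} (hq : IsDist q) {Q : β → ℝ} (hQ : IsDist Q)
    (hQ0 : ∀ y, 0 < Q y) : mutInfo W q ≤ ∑ x, q x * KL (W x) Q := by
  have hout := IsDist.output hW hq
  have key : ∀ y, ∑ x, q x * (W x y * Real.log (W x y / output W q y)) ≤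
      ∑ x, q x * (W x y * Real.log (W x y / Q y)) + (Q y - output W q y) := by
    intro y
    rcases (hout.1 y).eq_or_lt with h0 | hpos
    · have hz : ∀ x, q x * W x y = 0 := fun x =>
        (Finset.sum_eq_zero_iff_of_nonneg
          fun x _ => mul_nonneg (hq.1 x) ((hW x).1 y)).1 h0.symm x (Finset.mem_univ x)
      simp only [← mul_assoc, hz, zero_mul, Finset.sum_const_zero, ← h0]
      linarith [hQ0 y]
    · have hsum : ∑ x, q x * W x y * (Q y / output W q y - 1) = Q y - output W q y := by
        rw [← Finset.sum_mul]
        change output W q y * _ = _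
        field_simp
      rw [← hsum, ← Finset.sum_add_distrib]
      exact Finset.sum_le_sum fun x _ =>
        mul_log_div_le_mul_log_div_add (hq.1 x) ((hW x).1 y) hpos (hQ0 y)
  have h := Finset.sum_le_sum fun y (_ : y ∈ Finset.univ) => key y
  rw [Finset.sum_add_distrib, Finset.sum_sub_distrib, hQ.2, hout.2, sub_self, add_zero,
    Finset.sum_comm, Finset.sum_comm (f := fun y x => q x * (W x y * Real.log (W x y / Q y)))] at h
  simpa only [mutInfo, KL, Finset.mul_sum] using h

/-- A channel whose rows are equidistant from a positive achievable output law has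
capacity equal to the common divergence. -/
theorem capacity_eq_of_KL_eq {α β : Type*} [Fintype α] [Fintype β] {W : α → β → ℝ}
    (hW : ∀ x, IsDist (W x)) {q : α → ℝ} (hq : IsDist q) (hpos : ∀ y, 0 < output W q y)
    {C : ℝ} (hC : ∀ x, KL (W x) (output W q) = C) : capacity W = C := by
  have havg : ∀ p : α → ℝ, IsDist p → ∑ x, p x * KL (W x) (output W q) = C := fun p hp => by
    simp [hC, ← Finset.sum_mul, hp.2]
  refine IsGreatest.csSup_eq ⟨⟨q, hq, (havg q hq).symm⟩, ?_⟩
  rintro c ⟨p, hp, rfl⟩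
  exact (mutInfo_le_sum_mul_KL hW hp (IsDist.output hW hq) hpos).trans_eq (havg p hp)

/-- for the three-input channel `W₁ = (1−ε, 0, ε)`, `W₂ = (0, 1−ε, ε)`,
`W₃ = (1/2, 1/2, 0)` with `ε ∈ (0, 1/2]` and `h₄ = log 2 − h(ε)`, if
`((1−ε)/(2ε)) e^{h₄/ε} ≤ 1` then the capacity equals `log(1 + e^{h₄/ε}/2)`. -/
theorem stmt16 (ε : ℝ) (hε0 : 0 < ε) (hε : ε ≤ 1 / 2)
    (h₄ : ℝ) (hh₄ : h₄ = Real.log 2 - bent ε)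
    (hcond : (1 - ε) / (2 * ε) * Real.exp (h₄ / ε) ≤ 1) :
    capacity (![![1 - ε, 0, ε], ![0, 1 - ε, ε], ![1 / 2, 1 / 2, 0]]
        : Fin 3 → Fin 3 → ℝ)
      = Real.log (1 + Real.exp (h₄ / ε) / 2) := by
  have hε1 : 0 < 1 - ε := by linarith
  set E := Real.exp (h₄ / ε) with hE
  have hE0 : 0 < E := Real.exp_pos _
  have hlogE : ε * Real.log E = h₄ := by
    rw [hE, Real.log_exp]
    field_simp
  have hcond' : (1 - ε) * E ≤ 2 * ε := by
    rw [div_mul_eq_mul_div, div_le_one (by positivity)] at hcond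
    exact hcond
  have h2E : 0 < 2 + E := by positivity
  have hlogC : Real.log (1 + E / 2) = Real.log (2 + E) - Real.log 2 := by
    rw [← Real.log_div h2E.ne' two_ne_zero]
    congr 1
    field_simp
  have ha : 0 ≤ E / (2 * ε * (2 + E)) := by positivity
  have ha1 : 0 ≤ 1 - 2 * (E / (2 * ε * (2 + E))) := by
    have : 1 - 2 * (E / (2 * ε * (2 + E))) = (2 * ε - (1 - ε) * E) / (ε * (2 + E)) := by
      field_simp
      ring
    rw [this]
    exact div_nonneg (by linarith) (by positivity)
  let q : Fin 3 → ℝ := ![E / (2 * ε * (2 + E)), E / (2 * ε * (2 + E)),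
    1 - 2 * (E / (2 * ε * (2 + E)))]
  have hq : IsDist q := by
    refine ⟨fun i => ?_, ?_⟩
    · fin_cases i
      exacts [ha, ha, ha1]
    · simp only [q, Fin.sum_univ_three, Matrix.cons_val]
      ring
  have hout : output (![![1 - ε, 0, ε], ![0, 1 - ε, ε], ![1 / 2, 1 / 2, 0]]
      : Fin 3 → Fin 3 → ℝ) q = ![1 / (2 + E), 1 / (2 + E), E / (2 + E)] := by
    funext y
    fin_cases y <;> simp [output, q, Fin.sum_univ_three] <;> field_simp <;> ring
  have hlog : Real.log ((1 - ε) / (1 / (2 + E))) = Real.log (1 - ε) + Real.log (2 + E) := by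
    rw [div_div_eq_mul_div, div_one, Real.log_mul hε1.ne' h2E.ne']
  have hlog' : Real.log (ε / (E / (2 + E))) = Real.log ε + Real.log (2 + E) - Real.log E := by
    rw [div_div_eq_mul_div, Real.log_div (by positivity) hE0.ne',
      Real.log_mul hε0.ne' h2E.ne']
  have hlog'' : Real.log (1 / 2 / (1 / (2 + E))) = Real.log (2 + E) - Real.log 2 := by
    rw [← Real.log_div h2E.ne' two_ne_zero]
    congr 1
    field_simp
  have hrow : (1 - ε) * (Real.log (1 - ε) + Real.log (2 + E)) +
      ε * (Real.log ε + Real.log (2 + E) - Real.log E) = Real.log (2 + E) - Real.log 2 := by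
    rw [bent] at hh₄
    linarith
  refine capacity_eq_of_KL_eq (q := q) (fun x => ⟨fun y => ?_, ?_⟩) hq (fun y => ?_) fun x => ?_
  · fin_cases x <;> fin_cases y <;> simp <;> linarith
  · fin_cases x <;> simp [Fin.sum_univ_three]
    norm_num
  · rw [hout]
    fin_cases y <;> simp <;> positivity
  · rw [hout, hlogC]
    fin_cases x <;> simp only [KL, Fin.sum_univ_three, Matrix.cons_val, Fin.zero_eta, Fin.mk_one,
      Fin.reduceFinMk, zero_mul, add_zero, zero_add, hlog, hlog', hlog'']
    exacts [hrow, hrow, by ring]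
end

section
/- Let ε ∈ (0, 1/2) and consider the channel with input alphabet X = {1,2,3} and output alphabet Y = {1,2,3} given by W_1 = (1−ε, 0, ε), W_2 = (0, 1−ε, ε), W_3 = (1/2, 1/2, 0). Set h₄ = log 2 − h(ε). If ((1−ε)/(2ε))·exp(h₄/ε) > 1, then the capacity of this channel equals (1−ε)·log 2, attained by the uniform input distribution on {1,2}. -/
open Real Finset

/-- Mutual information is bounded by the average divergence to any positive reference output
distribution. -/
theorem mutInfo_le_sum_KL {α β : Type*} [Fintype α] [Fintype β]
    {W : α → β → ℝ} {q : α → ℝ} {p : β → ℝ} (hW : ∀ x, IsDist (W x)) (hq : IsDist q)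
    (hp : IsDist p) (hpos : ∀ y, 0 < p y) :
    mutInfo W q ≤ ∑ x, q x * KL (W x) p := by
  have hnn : ∀ x y, 0 ≤ q x * W x y := fun x y => mul_nonneg (hq.1 x) ((hW x).1 y)
  have hr : ∀ y, 0 ≤ output W q y := fun y => Finset.sum_nonneg fun x _ => hnn x y
  have hterm : ∀ x y, q x * W x y * Real.log (W x y / output W q y) ≤
      q x * W x y * Real.log (W x y / p y) + q x * W x y * (p y / output W q y - 1) := by
    intro x y
    rcases (hnn x y).eq_or_lt with h | h
    · simp [← h]
    · have hw : 0 < W x y := pos_of_mul_pos_right h (hq.1 x)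
      have hry : 0 < output W q y :=
        h.trans_le (Finset.single_le_sum (f := fun x => q x * W x y)
          (fun x _ => hnn x y) (Finset.mem_univ x))
      rw [← mul_add]
      refine mul_le_mul_of_nonneg_left ?_ h.le
      have hlog := Real.log_le_sub_one_of_pos (div_pos (hpos y) hry)
      rw [Real.log_div (hpos y).ne' hry.ne'] at hlog
      rw [Real.log_div hw.ne' hry.ne', Real.log_div hw.ne' (hpos y).ne']
      linarith
  have hcol : ∀ y, ∑ x, q x * W x y * (p y / output W q y - 1) ≤ p y - output W q y := by
    intro y
    rw [← Finset.sum_mul]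
    change output W q y * (p y / output W q y - 1) ≤ _
    rcases (hr y).eq_or_lt with h | h
    · simpa [← h] using (hpos y).le
    · exact le_of_eq (by field_simp)
  have hout : ∑ y, output W q y = 1 := by
    unfold output
    rw [Finset.sum_comm]
    simp [← Finset.mul_sum, (hW _).2, hq.2]
  have hrem : ∑ x, ∑ y, q x * W x y * (p y / output W q y - 1) ≤ 0 := by
    rw [Finset.sum_comm]
    refine (Finset.sum_le_sum fun y _ => hcol y).trans ?_
    rw [Finset.sum_sub_distrib, hout, hp.2, sub_self]
  have hsum := Finset.sum_le_sum fun x (_ : x ∈ Finset.univ) =>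
    Finset.sum_le_sum fun y (_ : y ∈ Finset.univ) => hterm x y
  simp only [Finset.sum_add_distrib] at hsum
  simp only [mutInfo, KL, Finset.mul_sum, ← mul_assoc]
  linarith

/-- If every row of a channel is within divergence `c` of a common positive reference
distribution, and some input distribution has mutual information `c`, then the capacity is `c`. -/
theorem capacity_eq_of_KL_le {α β : Type*} [Fintype α] [Fintype β]
    {W : α → β → ℝ} {q₀ : α → ℝ} {p : β → ℝ} {c : ℝ} (hW : ∀ x, IsDist (W x))
    (hp : IsDist p) (hpos : ∀ y, 0 < p y) (hKL : ∀ x, KL (W x) p ≤ c)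
    (hq₀ : IsDist q₀) (hc : mutInfo W q₀ = c) :
    capacity W = c := by
  refine IsGreatest.csSup_eq ⟨⟨q₀, hq₀, hc.symm⟩, ?_⟩
  rintro _ ⟨q, hq, rfl⟩
  calc mutInfo W q ≤ ∑ x, q x * KL (W x) p := mutInfo_le_sum_KL hW hq hp hpos
    _ ≤ ∑ x, q x * c :=
        Finset.sum_le_sum fun x _ => mul_le_mul_of_nonneg_left (hKL x) (hq.1 x)
    _ = c := by rw [← Finset.sum_mul, hq.2, one_mul]

/-- The exponential threshold condition in logarithmic form. -/
theorem neg_log_one_sub_lt_of_threshold {ε : ℝ} (hε0 : 0 < ε) (hε : ε < 1)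
    (hcond : 1 < (1 - ε) / (2 * ε) * Real.exp ((Real.log 2 - bent ε) / ε)) :
    -Real.log (1 - ε) < (1 - ε) * Real.log 2 := by
  have h1 : 0 < 1 - ε := by linarith
  have h := Real.log_pos hcond
  rw [Real.log_mul (by positivity) (Real.exp_ne_zero _), Real.log_exp,
    Real.log_div h1.ne' (by positivity), Real.log_mul two_ne_zero hε0.ne', bent] at h
  have h' := mul_pos hε0 h
  rw [mul_add, mul_div_cancel₀ _ hε0.ne'] at h'
  linarith

/-- for the three-input channel `W₁ = (1−ε, 0, ε)`, `W₂ = (0, 1−ε, ε)`,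
`W₃ = (1/2, 1/2, 0)` with `ε ∈ (0, 1/2)` and `h₄ = log 2 − h(ε)`, if
`((1−ε)/(2ε)) e^{h₄/ε} > 1` then the capacity equals `(1−ε) log 2`, attained by
the uniform input distribution on `{1, 2}`. -/
theorem stmt17 (ε : ℝ) (hε0 : 0 < ε) (hε : ε < 1 / 2)
    (h₄ : ℝ) (hh₄ : h₄ = Real.log 2 - bent ε)
    (hcond : 1 < (1 - ε) / (2 * ε) * Real.exp (h₄ / ε)) :
    capacity (![![1 - ε, 0, ε], ![0, 1 - ε, ε], ![1 / 2, 1 / 2, 0]]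
          : Fin 3 → Fin 3 → ℝ)
        = (1 - ε) * Real.log 2 ∧
      mutInfo (![![1 - ε, 0, ε], ![0, 1 - ε, ε], ![1 / 2, 1 / 2, 0]]
          : Fin 3 → Fin 3 → ℝ) ![1 / 2, 1 / 2, 0]
        = (1 - ε) * Real.log 2 := by
  subst hh₄
  have h1 : 0 < 1 - ε := by linarith
  have hlog := neg_log_one_sub_lt_of_threshold hε0 (by linarith) hcond
  have htwo : (1 - ε) / ((1 - ε) / 2) = 2 := by field_simp
  have hinv : 1 / 2 / ((1 - ε) / 2) = (1 - ε)⁻¹ := by field_simp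
  have hmut : mutInfo (![![1 - ε, 0, ε], ![0, 1 - ε, ε], ![1 / 2, 1 / 2, 0]]
      : Fin 3 → Fin 3 → ℝ) ![1 / 2, 1 / 2, 0] = (1 - ε) * Real.log 2 := by
    have e1 : (1 / 2 : ℝ) * (1 - ε) = (1 - ε) / 2 := by ring
    have e2 : (1 / 2 : ℝ) * ε + 1 / 2 * ε = ε := by ring
    simp only [mutInfo, KL, output, Fin.sum_univ_three, Matrix.cons_val, mul_zero, zero_mul,
      add_zero, zero_add, e1, e2, htwo, div_self hε0.ne', Real.log_one]
    ring
  refine ⟨capacity_eq_of_KL_le (p := ![(1 - ε) / 2, (1 - ε) / 2, ε]) ?_ ?_ ?_ ?_ ?_ hmut, hmut⟩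
  · intro x
    constructor
    · intro y
      fin_cases x <;> fin_cases y <;> simp <;> linarith
    · fin_cases x <;> simp [Fin.sum_univ_three]
      norm_num
  · constructor
    · intro y
      fin_cases y <;> simp <;> linarith
    · simp [Fin.sum_univ_three]
  · intro y
    fin_cases y <;> simp <;> linarith
  · intro x
    fin_cases x
    · simp [KL, Fin.sum_univ_three, htwo, div_self hε0.ne']
    · simp [KL, Fin.sum_univ_three, htwo, div_self hε0.ne']
    · simp only [KL, Fin.sum_univ_three, Fin.reduceFinMk, Matrix.cons_val, hinv, Real.log_inv]
      linarith
  · constructor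
    · intro x
      fin_cases x <;> simp
    · simp only [Fin.sum_univ_three, Matrix.cons_val]
      norm_num
end

section
/- Let ε ∈ (0, 1/2) and consider the channel with input alphabet X = {3,4} and output alphabet Y = {1,2,3} given by W_3 = (1/2, 1/2, 0) and W_4 = (1/2−ε, 1/2−ε, 2ε). For the input distribution putting probability p on input 4 and 1−p on input 3, the mutual information equals h(2εp) − p·h(2ε); it is maximized at p* = 1/(2ε + (1−2ε)^{−(1−2ε)/(2ε)}), so the capacity of this channel equals h(2ε·p*) − p*·h(2ε). -/
open Real Finset

/-- The term `s log (t / s)` is at most `t - s`. -/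
lemma mul_log_sub_mul_log_le {s t : ℝ} (hs : 0 ≤ s) (ht : 0 < t) :
    s * Real.log t - s * Real.log s ≤ t - s := by
  rcases hs.eq_or_lt with rfl | hs
  · simpa using ht.le
  · have h := Real.log_le_sub_one_of_pos (div_pos ht hs)
    rw [Real.log_div ht.ne' hs.ne'] at h
    calc s * Real.log t - s * Real.log s = s * (Real.log t - Real.log s) := by ring
      _ ≤ s * (t / s - 1) := by gcongr
      _ = t - s := by field_simp

/-- Gibbs' inequality for binary distributions. -/
lemma bent_le_crossEntropy {s t : ℝ} (hs0 : 0 ≤ s) (hs1 : s ≤ 1) (ht0 : 0 < t) (ht1 : t < 1) :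
    bent s ≤ -(s * Real.log t) - (1 - s) * Real.log (1 - t) := by
  have h₁ := mul_log_sub_mul_log_le hs0 ht0
  have h₂ := mul_log_sub_mul_log_le (sub_nonneg.2 hs1) (sub_pos.2 ht1)
  unfold bent
  linarith

/-- If the slope of the binary entropy at `a * r` matches the chord slope `bent a / a`, then
`p ↦ bent (a * p) - p * bent a` is maximal at `r`. -/
lemma bent_mul_sub_le {a r p : ℝ} (ha0 : 0 ≤ a) (ha1 : a ≤ 1) (hr0 : 0 < a * r) (hr1 : a * r < 1)
    (hr : a * (Real.log (1 - a * r) - Real.log (a * r)) = bent a) (hp0 : 0 ≤ p) (hp1 : p ≤ 1) :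
    bent (a * p) - p * bent a ≤ bent (a * r) - r * bent a := by
  have h := bent_le_crossEntropy (mul_nonneg ha0 hp0) (mul_le_one₀ ha1 hp0 hp1) hr0 hr1
  have hval : bent (a * r) - r * bent a = -Real.log (1 - a * r) := by
    rw [← hr, bent]
    ring
  rw [hval, ← hr]
  linarith

/-- The stationary point of `p ↦ bent (a * p) - p * bent a`. -/
lemma mul_log_sub_log_eq_bent {a r : ℝ} (ha0 : 0 < a) (ha1 : a < 1)
    (hr : r = 1 / (a + (1 - a) ^ (-(1 - a) / a))) :
    a * (Real.log (1 - a * r) - Real.log (a * r)) = bent a := by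
  have hB : 0 < (1 - a) ^ (-(1 - a) / a) := Real.rpow_pos_of_pos (sub_pos.2 ha1) _
  have hlog := Real.log_rpow (sub_pos.2 ha1) (-(1 - a) / a)
  generalize (1 - a) ^ (-(1 - a) / a) = B at hr hB hlog
  have hS : 0 < a + B := by positivity
  have h₁ : a * r = a / (a + B) := by rw [hr]; ring
  have h₂ : 1 - a * r = B / (a + B) := by rw [h₁]; field_simp; ring
  rw [h₁] at h₂ ⊢
  rw [h₂, Real.log_div hB.ne' hS.ne', Real.log_div ha0.ne' hS.ne', hlog, bent]
  field_simp
  ring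

/-- The mutual information of the channel with rows `(1/2, 1/2, 0)` and
`(1/2 - ε, 1/2 - ε, 2ε)`. -/
lemma mutInfo_eq_bent_sub {ε p : ℝ} (hε0 : 0 < ε) (hε : ε < 1 / 2) (hp0 : 0 ≤ p) (hp1 : p ≤ 1) :
    mutInfo (![![1 / 2, 1 / 2, 0], ![1 / 2 - ε, 1 / 2 - ε, 2 * ε]]
        : Fin 2 → Fin 3 → ℝ) ![1 - p, p]
      = bent (2 * ε * p) - p * bent (2 * ε) := by
  have hu : 0 < 1 - 2 * ε * p := by nlinarith
  have ha : 0 < 1 - 2 * ε := by linarith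
  have hout : (1 - p) * (1 / 2) + p * (1 / 2 - ε) = (1 - 2 * ε * p) / 2 := by ring
  have h₁ : Real.log (1 / 2 / ((1 - 2 * ε * p) / 2)) = -Real.log (1 - 2 * ε * p) := by
    rw [div_div_div_cancel_right₀ two_ne_zero, one_div, Real.log_inv]
  have h₂ : Real.log ((1 / 2 - ε) / ((1 - 2 * ε * p) / 2))
      = Real.log (1 - 2 * ε) - Real.log (1 - 2 * ε * p) := by
    rw [← Real.log_div ha.ne' hu.ne']
    congr 1
    field_simp
  have h₃ : p * Real.log (2 * ε / (p * (2 * ε)))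
      = p * (Real.log (2 * ε) - Real.log (2 * ε * p)) := by
    rcases hp0.eq_or_lt with rfl | hp
    · simp
    · rw [mul_comm p (2 * ε), Real.log_div (by positivity) (by positivity)]
  simp only [mutInfo, KL, output, Fin.sum_univ_two, Fin.sum_univ_three, Matrix.cons_val_zero,
    Matrix.cons_val_one, Matrix.cons_val, hout, h₁, h₂, bent, mul_zero, zero_add, zero_mul,
    add_zero]
  linear_combination (2 * ε) * h₃

/-- for the two-input channel `W₃ = (1/2, 1/2, 0)`,
`W₄ = (1/2−ε, 1/2−ε, 2ε)` with `ε ∈ (0, 1/2)`, the mutual information of the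
input distribution `(1−p, p)` equals `h(2εp) − p·h(2ε)`; it is maximized at
`p* = 1/(2ε + (1−2ε)^{−(1−2ε)/(2ε)})`, and the capacity equals
`h(2ε·p*) − p*·h(2ε)`. -/
theorem stmt19 (ε : ℝ) (hε0 : 0 < ε) (hε : ε < 1 / 2)
    (pstar : ℝ)
    (hpstar : pstar = 1 / (2 * ε + (1 - 2 * ε) ^ (-(1 - 2 * ε) / (2 * ε)))) :
    (∀ p : ℝ, 0 ≤ p → p ≤ 1 →
        mutInfo (![![1 / 2, 1 / 2, 0], ![1 / 2 - ε, 1 / 2 - ε, 2 * ε]]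
            : Fin 2 → Fin 3 → ℝ) ![1 - p, p]
          = bent (2 * ε * p) - p * bent (2 * ε)) ∧
    (∀ p : ℝ, 0 ≤ p → p ≤ 1 →
        bent (2 * ε * p) - p * bent (2 * ε)
          ≤ bent (2 * ε * pstar) - pstar * bent (2 * ε)) ∧
    capacity (![![1 / 2, 1 / 2, 0], ![1 / 2 - ε, 1 / 2 - ε, 2 * ε]]
        : Fin 2 → Fin 3 → ℝ)
      = bent (2 * ε * pstar) - pstar * bent (2 * ε) := by
  have hB : 1 ≤ (1 - 2 * ε) ^ (-(1 - 2 * ε) / (2 * ε)) :=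
    Real.one_le_rpow_of_pos_of_le_one_of_nonpos (by linarith) (by linarith)
      (div_nonpos_of_nonpos_of_nonneg (by linarith) (by linarith))
  have hr0 : 0 < pstar := by
    rw [hpstar]
    positivity
  have hr1 : pstar ≤ 1 := by
    rw [hpstar]
    exact (div_le_one (by positivity)).2 (by linarith)
  have hmax : ∀ p : ℝ, 0 ≤ p → p ≤ 1 →
      bent (2 * ε * p) - p * bent (2 * ε)
        ≤ bent (2 * ε * pstar) - pstar * bent (2 * ε) := fun p hp0 hp1 =>
    bent_mul_sub_le (by linarith) (by linarith) (by positivity) (by nlinarith)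
      (mul_log_sub_log_eq_bent (by linarith) (by linarith) hpstar) hp0 hp1
  refine ⟨fun p hp0 hp1 => mutInfo_eq_bent_sub hε0 hε hp0 hp1, hmax, ?_⟩
  refine IsGreatest.csSup_eq ⟨⟨![1 - pstar, pstar], ⟨?_, by simp⟩,
    (mutInfo_eq_bent_sub hε0 hε hr0.le hr1).symm⟩, ?_⟩
  · intro i
    fin_cases i
    · simpa using hr1
    · simpa using hr0.le
  · rintro c ⟨q, ⟨hq0, hq1⟩, rfl⟩
    rw [Fin.sum_univ_two] at hq1
    have hq : q = ![1 - q 1, q 1] := by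
      ext i
      fin_cases i
      · simp [← hq1]
      · simp
    have hle : q 1 ≤ 1 := by linarith [hq0 0]
    rw [hq, mutInfo_eq_bent_sub hε0 hε (hq0 1) hle]
    exact hmax _ (hq0 1) hle
end
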